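/- Fix an integer G ≥ 1 and positive reals k_on, k_1, …, k_G, λ, λ_1. Then FF^P(0) = 1 + λ_1/λ − (λ_1/λ) · e_G(k_1,…,k_G) e_{G−2}(k_1,…,k_G)/e_{G−1}(k_1,…,k_G)², and FF^P(0) ≥ 1 + λ_1/(2λ) + λ_1/(2λG), with equality if and only if k_1 = k_2 = … = k_G. -/

import Mathlib

/-- Elementary symmetric polynomial of (integer) degree `g` in the variables
`x i` for `i ∈ s`, with the conventions `e_0 = 1` and `e_g = 0` for `g < 0`
or `g > card s`. -/
noncomputable def esymm (x : ℕ → ℝ) (s : Finset ℕ) (g : ℤ) : ℝ :=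
  if 0 ≤ g then ∑ t ∈ s.powersetCard g.toNat, ∏ i ∈ t, x i else 0

/-- Fano factor of protein number fluctuations from the slow-scale linear
noise approximation; `lam` is the cytoplasmic mRNA degradation rate and
`lam1` the protein production rate. -/
noncomputable def FFP (G : ℕ) (k : ℕ → ℝ) (kon koff lam lam1 : ℝ) : ℝ :=
  1 + lam1 / (2 * lam) + lam1 / (2 * lam) *
      (esymm (fun i => (k i) ^ 2) (Finset.Icc 2 G) ((G : ℤ) - 1) *
          (koff ^ 2 + 2 * koff * (kon + k 1))
        + kon ^ 2 * esymm (fun i => (k i) ^ 2) (Finset.Icc 1 G) ((G : ℤ) - 1)) /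
      (koff * esymm k (Finset.Icc 2 G) ((G : ℤ) - 1)
        + kon * esymm k (Finset.Icc 1 G) ((G : ℤ) - 1)) ^ 2

lemma aux_compl (x : ℕ → ℝ) (s : Finset ℕ) (j : ℕ) (hj : j ≤ s.card)
    (hx : ∀ i ∈ s, x i ≠ 0) :
    ∑ t ∈ s.powersetCard (s.card - j), ∏ i ∈ t, x i =
      (∏ i ∈ s, x i) * ∑ t ∈ s.powersetCard j, ∏ i ∈ t, (x i)⁻¹ := by
  rw [Finset.mul_sum]
  refine Finset.sum_bij' (fun t _ => s \ t) (fun t _ => s \ t) ?_ ?_ ?_ ?_ ?_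
  · intro t ht
    rw [Finset.mem_powersetCard] at ht ⊢
    refine ⟨Finset.sdiff_subset, ?_⟩
    rw [Finset.card_sdiff_of_subset ht.1, ht.2]
    omega
  · intro t ht
    rw [Finset.mem_powersetCard] at ht ⊢
    refine ⟨Finset.sdiff_subset, ?_⟩
    rw [Finset.card_sdiff_of_subset ht.1, ht.2]
  · intro t ht
    rw [Finset.mem_powersetCard] at ht
    exact Finset.sdiff_sdiff_eq_self ht.1
  · intro t ht
    rw [Finset.mem_powersetCard] at ht
    exact Finset.sdiff_sdiff_eq_self ht.1
  · intro t ht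
    rw [Finset.mem_powersetCard] at ht
    rw [← Finset.prod_sdiff ht.1, Finset.prod_inv_distrib]
    have : ∏ i ∈ s \ t, x i ≠ 0 :=
      Finset.prod_ne_zero_iff.mpr fun i hi => hx i (Finset.mem_sdiff.mp hi).1
    field_simp

lemma aux_one (y : ℕ → ℝ) (s : Finset ℕ) :
    ∑ t ∈ s.powersetCard 1, ∏ i ∈ t, y i = ∑ i ∈ s, y i := by
  simp [Finset.powersetCard_one]

lemma aux_two (y : ℕ → ℝ) (s : Finset ℕ) :
    2 * ∑ t ∈ s.powersetCard 2, ∏ i ∈ t, y i = (∑ i ∈ s, y i) ^ 2 - ∑ i ∈ s, y i ^ 2 := by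
  induction s using Finset.induction_on with
  | empty => rw [Finset.powersetCard_eq_empty.mpr (by simp)]; simp
  | insert a s ha ih =>
    have hd : Disjoint (s.powersetCard 2) ((s.powersetCard 1).image (insert a)) := by
      rw [Finset.disjoint_left]
      intro t ht ht'
      obtain ⟨u, -, rfl⟩ := Finset.mem_image.mp ht'
      exact ha ((Finset.mem_powersetCard.mp ht).1 (Finset.mem_insert_self a u))
    have himg : ∑ t ∈ (s.powersetCard 1).image (insert a), ∏ i ∈ t, y i
        = y a * ∑ i ∈ s, y i := by
      rw [← aux_one, Finset.mul_sum, Finset.sum_image]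
      · refine Finset.sum_congr rfl fun t ht => ?_
        rw [Finset.prod_insert]
        exact fun h => ha ((Finset.mem_powersetCard.mp ht).1 h)
      · intro t ht u hu h
        have h1 : a ∉ t := fun h => ha ((Finset.mem_powersetCard.mp ht).1 h)
        have h2 : a ∉ u := fun h => ha ((Finset.mem_powersetCard.mp hu).1 h)
        rw [← Finset.erase_insert h1, ← Finset.erase_insert h2, h]
    rw [Finset.powersetCard_succ_insert ha, Finset.sum_union hd, himg,
      Finset.sum_insert ha, Finset.sum_insert ha, mul_add, ih]
    ring

lemma aux_var (y : ℕ → ℝ) (s : Finset ℕ) (c : ℝ) (hc : c = s.card) :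
    ∑ i ∈ s, (c * y i - ∑ j ∈ s, y j) ^ 2
      = c * (c * ∑ i ∈ s, y i ^ 2 - (∑ i ∈ s, y i) ^ 2) := by
  set S := ∑ j ∈ s, y j with hS
  have : ∀ i ∈ s, (c * y i - S) ^ 2 = c ^ 2 * y i ^ 2 - 2 * c * S * y i + S ^ 2 := by
    intros; ring
  rw [Finset.sum_congr rfl this, Finset.sum_add_distrib, Finset.sum_sub_distrib,
    ← Finset.mul_sum, ← Finset.mul_sum, Finset.sum_const, nsmul_eq_mul, ← hc, ← hS]
  ring

/-- value of the protein Fano factor at `koff = 0` and its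
lower bound `1 + λ₁/(2λ) + λ₁/(2λG)`, attained exactly when all the
initiation rates are equal. -/
theorem FFP_at_koff_zero_lower_bound
    (G : ℕ) (hG : 1 ≤ G)
    (kon lam lam1 : ℝ) (k : ℕ → ℝ)
    (hkon : 0 < kon) (hlam : 0 < lam) (hlam1 : 0 < lam1)
    (hk : ∀ i ∈ Finset.Icc 1 G, 0 < k i) :
    FFP G k kon 0 lam lam1 =
      1 + lam1 / lam - lam1 / lam *
        (esymm k (Finset.Icc 1 G) (G : ℤ) * esymm k (Finset.Icc 1 G) ((G : ℤ) - 2)) /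
        esymm k (Finset.Icc 1 G) ((G : ℤ) - 1) ^ 2 ∧
    1 + lam1 / (2 * lam) + lam1 / (2 * lam * (G : ℝ)) ≤ FFP G k kon 0 lam lam1 ∧
    (FFP G k kon 0 lam lam1 = 1 + lam1 / (2 * lam) + lam1 / (2 * lam * (G : ℝ)) ↔
      ∀ i ∈ Finset.Icc 1 G, ∀ j ∈ Finset.Icc 1 G, k i = k j) := by
  have hcard : (Finset.Icc 1 G).card = G := by simp
  have hne : ∀ i ∈ Finset.Icc 1 G, k i ≠ 0 := fun i hi => (hk i hi).ne'
  set s := Finset.Icc 1 G with hs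
  set P := ∏ i ∈ s, k i with hP
  set S1 := ∑ i ∈ s, (k i)⁻¹ with hS1
  set S2 := ∑ i ∈ s, (k i)⁻¹ ^ 2 with hS2
  have hGpos : (0 : ℝ) < G := by exact_mod_cast hG
  have hPpos : 0 < P := Finset.prod_pos hk
  have hS1pos : 0 < S1 := by
    refine Finset.sum_pos (fun i hi => inv_pos.mpr (hk i hi)) ?_
    exact ⟨1, by simp [hs, hG]⟩
  have e0 : esymm k s (G : ℤ) = P := by
    have := aux_compl k s 0 (by omega) hne
    rw [hcard] at this
    simpa [esymm] using this
  have t1 : ((G : ℤ) - 1).toNat = G - 1 := by omega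
  have p1 : (0 : ℤ) ≤ (G : ℤ) - 1 := by omega
  have e1 : esymm k s ((G : ℤ) - 1) = P * S1 := by
    have := aux_compl k s 1 (by omega) hne
    rw [hcard, aux_one (fun i => (k i)⁻¹)] at this
    rw [esymm, if_pos p1, t1, this]
  have e1' : esymm (fun i => (k i) ^ 2) s ((G : ℤ) - 1) = P ^ 2 * S2 := by
    have := aux_compl (fun i => (k i) ^ 2) s 1 (by omega) (fun i hi => pow_ne_zero 2 (hne i hi))
    rw [hcard, aux_one (fun i => (k i ^ 2)⁻¹), Finset.prod_pow] at this
    rw [esymm, if_pos p1, t1, this, hS2]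
    simp only [inv_pow]
    rfl
  have e2 : 2 * esymm k s ((G : ℤ) - 2) = P * (S1 ^ 2 - S2) := by
    have h2 := aux_two (fun i => (k i)⁻¹) s
    rw [hS1, hS2, ← h2]
    by_cases h : 2 ≤ G
    · have := aux_compl k s 2 (by omega) hne
      rw [hcard] at this
      have t2 : ((G : ℤ) - 2).toNat = G - 2 := by omega
      rw [esymm, if_pos (by omega), t2, this]
      ring
    · rw [esymm, if_neg (by omega), Finset.powersetCard_eq_empty.mpr (by omega)]
      simp
  have hF : FFP G k kon 0 lam lam1 = 1 + lam1 / (2 * lam) + lam1 / (2 * lam) * (S2 / S1 ^ 2) := by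
    rw [FFP, ← hs, e1, e1']
    field_simp
    ring
  have hvar := aux_var (fun i => (k i)⁻¹) s G (by rw [hcard])
  simp only [← hS1, ← hS2] at hvar
  have hD : FFP G k kon 0 lam lam1 - (1 + lam1 / (2 * lam) + lam1 / (2 * lam * (G : ℝ)))
      = lam1 / (2 * lam * G ^ 2 * S1 ^ 2) * ∑ i ∈ s, ((G : ℝ) * (k i)⁻¹ - S1) ^ 2 := by
    rw [hF, hvar]
    field_simp
    ring
  have hc : 0 < lam1 / (2 * lam * G ^ 2 * S1 ^ 2) := by positivity
  have hnn : 0 ≤ ∑ i ∈ s, ((G : ℝ) * (k i)⁻¹ - S1) ^ 2 :=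
    Finset.sum_nonneg fun i _ => sq_nonneg _
  refine ⟨?_, ?_, ?_⟩
  · have e2' : esymm k s ((G : ℤ) - 2) = P * (S1 ^ 2 - S2) / 2 := by linarith
    rw [hF, e0, e1, e2']
    field_simp
    ring
  · have := mul_nonneg hc.le hnn
    linarith
  · rw [← sub_eq_zero, hD, mul_eq_zero, or_iff_right hc.ne',
      Finset.sum_eq_zero_iff_of_nonneg fun i _ => sq_nonneg _]
    constructor
    · intro h i hi j hj
      have hi' := pow_eq_zero_iff (two_ne_zero) |>.mp (h i hi)
      have hj' := pow_eq_zero_iff (two_ne_zero) |>.mp (h j hj)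
      have : (G : ℝ) * (k i)⁻¹ = G * (k j)⁻¹ := by linarith
      exact inv_injective (mul_left_cancel₀ hGpos.ne' this)
    · intro h i hi
      have : S1 = G * (k i)⁻¹ := by
        rw [hS1, Finset.sum_congr rfl fun j hj => by rw [h j hj i hi], Finset.sum_const,
          hcard, nsmul_eq_mul]
      rw [this]
      ring
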